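/- Let S1 and S2 be finite nonempty strategy sets and let u1, u2 : S1 × S2 → ℝ be payoff functions such that the sum u1(a1, a2) + u2(a1, a2) depends only on a2, i.e., there exists a function g : S2 → ℝ with u1(a1, a2) + u2(a1, a2) = g(a2) for all (a1, a2). Then the game (u1, u2) is strategically equivalent to the zero-sum game (−u2, u2): a pair of mixed strategies (σ1, σ2) is a Nash equilibrium of (u1, u2) if and only if it is a Nash equilibrium of (−u2, u2). -/

import Mathlib

/-- A mixed strategy over a finite strategy set: nonnegative and sums to one. -/
def IsMixed {S : Type*} [Fintype S] (σ : S → ℝ) : Prop :=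
  (∀ a, 0 ≤ σ a) ∧ ∑ a, σ a = 1

/-- Expected payoff under a mixed strategy profile. -/
def expPayoff {S1 S2 : Type*} [Fintype S1] [Fintype S2]
    (u : S1 × S2 → ℝ) (σ1 : S1 → ℝ) (σ2 : S2 → ℝ) : ℝ :=
  ∑ a1, ∑ a2, σ1 a1 * σ2 a2 * u (a1, a2)

/-- (σ1, σ2) is a Nash equilibrium of the two-player game (u1, u2). -/
def IsNash {S1 S2 : Type*} [Fintype S1] [Fintype S2]
    (u1 u2 : S1 × S2 → ℝ) (σ1 : S1 → ℝ) (σ2 : S2 → ℝ) : Prop :=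
  IsMixed σ1 ∧ IsMixed σ2 ∧
  (∀ τ : S1 → ℝ, IsMixed τ → expPayoff u1 τ σ2 ≤ expPayoff u1 σ1 σ2) ∧
  (∀ τ : S2 → ℝ, IsMixed τ → expPayoff u2 σ1 τ ≤ expPayoff u2 σ1 σ2)

/-- If `u1 + u2` depends only on the second strategy, the payoff of a mixed strategy of player 1
differs from the one under `-u2` by a term independent of that strategy. -/
theorem expPayoff_eq_expPayoff_neg_add {S1 S2 : Type*} [Fintype S1] [Fintype S2]
    {u1 u2 : S1 × S2 → ℝ} {g : S2 → ℝ} (hg : ∀ a1 a2, u1 (a1, a2) + u2 (a1, a2) = g a2)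
    {τ : S1 → ℝ} (hτ : ∑ a, τ a = 1) (σ2 : S2 → ℝ) :
    expPayoff u1 τ σ2 = expPayoff (fun a => -u2 a) τ σ2 + ∑ a2, σ2 a2 * g a2 := by
  have hsum : ∑ a1, ∑ a2, τ a1 * (σ2 a2 * g a2) = ∑ a2, σ2 a2 * g a2 := by
    rw [← Finset.sum_mul_sum, hτ, one_mul]
  rw [← hsum]
  simp only [expPayoff, ← Finset.sum_add_distrib]
  refine Finset.sum_congr rfl fun a1 _ => Finset.sum_congr rfl fun a2 _ => ?_
  rw [← hg a1 a2]
  ring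

theorem strategic_equivalence_sum_depends_only_on_a2
    {S1 S2 : Type*} [Fintype S1] [Fintype S2] [Nonempty S1] [Nonempty S2]
    (u1 u2 : S1 × S2 → ℝ)
    (h : ∃ g : S2 → ℝ, ∀ a1 a2, u1 (a1, a2) + u2 (a1, a2) = g a2)
    (σ1 : S1 → ℝ) (σ2 : S2 → ℝ) :
    IsNash u1 u2 σ1 σ2 ↔ IsNash (fun a => -u2 a) u2 σ1 σ2 := by
  obtain ⟨g, hg⟩ := h
  refine and_congr_right fun h1 => and_congr_right fun _ => and_congr_left fun _ =>
    forall₂_congr fun τ hτ => ?_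
  rw [expPayoff_eq_expPayoff_neg_add hg hτ.2, expPayoff_eq_expPayoff_neg_add hg h1.2,
    add_le_add_iff_right]
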